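/- arXiv:2011.06763 — 3 statements merged into one kernel-verified Lean document; each statement's English description precedes it below -/
import Mathlib

section
/- Let (H, ⊆) be a ring of sets over a finite base set B with minimal element H0, and let H ∈ H. If H = (⋃_{K ∈ D̄} K) ∪ H0 for some subset D̄ of D(H), then D̄ is an upper set of the poset (D(H), ⊒). -/
/-- `H(a)`: the intersection of all members of the ring of sets `H` containing `a`
(all of `B` if no member contains `a`). -/
def minContaining {B : Type*} [Fintype B] [DecidableEq B]
    (H : Finset (Finset B)) (a : B) : Finset B :=
  Finset.univ.filter (fun b => ∀ Hm ∈ H, a ∈ Hm → b ∈ Hm)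

/-- `K(Hm)`: the centers of `Hm`, i.e. the elements `a` of the maximal element `Hz`
with `H(a) = Hm`. -/
def centers {B : Type*} [Fintype B] [DecidableEq B]
    (H : Finset (Finset B)) (Hz : Finset B) (Hm : Finset B) : Finset B :=
  Hz.filter (fun a => minContaining H a = Hm)

/-- `D(H)`: the sets of centers of the irreducible elements of `H` other than the
minimal element `H0`. -/
def Dset {B : Type*} [Fintype B] [DecidableEq B]
    (H : Finset (Finset B)) (Hz H0 : Finset B) : Finset (Finset B) :=
  (H.filter (fun Hm => Hm ≠ H0 ∧ ∃ a ∈ Hz, minContaining H a = Hm)).image (centers H Hz)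

/-- `Hm` is an irreducible element of the ring of sets `H`. -/
def Irred {B : Type*} [Fintype B] [DecidableEq B]
    (H : Finset (Finset B)) (Hz : Finset B) (Hm : Finset B) : Prop :=
  Hm ∈ H ∧ ∃ a ∈ Hz, minContaining H a = Hm

/-- The partial order `⊒` on `D(H)`: `K1 ⊒ K2` iff `I(K1) ⊆ I(K2)`, where `I(K)` is the
irreducible element whose set of centers is `K`. -/
def SqSupseteq {B : Type*} [Fintype B] [DecidableEq B]
    (H : Finset (Finset B)) (Hz : Finset B) (K1 K2 : Finset B) : Prop :=
  ∀ H1 H2 : Finset B, Irred H Hz H1 → Irred H Hz H2 →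
    centers H Hz H1 = K1 → centers H Hz H2 = K2 → H1 ⊆ H2

theorem mem_minContaining_self {B : Type*} [Fintype B] [DecidableEq B]
    (H : Finset (Finset B)) (a : B) : a ∈ minContaining H a := by
  simp [minContaining]

theorem minContaining_subset {B : Type*} [Fintype B] [DecidableEq B]
    {H : Finset (Finset B)} {S : Finset B} {a : B} (hS : S ∈ H) (ha : a ∈ S) :
    minContaining H a ⊆ S :=
  fun _ hb => (Finset.mem_filter.1 hb).2 S hS ha

/-- Let `(H, ⊆)` be a ring of sets over a finite base set `B` with
minimal element `H0`, and let `Hm ∈ H`. If `Hm = (⋃_{K ∈ D̄} K) ∪ H0` for some subset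
`D̄` of `D(H)`, then `D̄` is an upper set of the poset `(D(H), ⊒)`. -/
theorem stmt_7 {B : Type*} [Fintype B] [DecidableEq B]
    (H : Finset (Finset B)) (hne : H.Nonempty)
    (hcup : ∀ H1 ∈ H, ∀ H2 ∈ H, H1 ∪ H2 ∈ H)
    (hcap : ∀ H1 ∈ H, ∀ H2 ∈ H, H1 ∩ H2 ∈ H)
    (H0 Hz : Finset B)
    (hH0 : H0 ∈ H) (hH0min : ∀ Hm ∈ H, H0 ⊆ Hm)
    (hHz : Hz ∈ H) (hHzmax : ∀ Hm ∈ H, Hm ⊆ Hz)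
    (Hm : Finset B) (hHm : Hm ∈ H)
    (Dbar : Finset (Finset B)) (hDbar : Dbar ⊆ Dset H Hz H0)
    (heq : Hm = Dbar.sup id ∪ H0) :
    ∀ K1 ∈ Dset H Hz H0, ∀ K2 ∈ Dbar, SqSupseteq H Hz K1 K2 → K1 ∈ Dbar := by
  intro K1 hK1 K2 hK2 hle
  obtain ⟨I1, hI1, rfl⟩ := Finset.mem_image.1 hK1
  obtain ⟨I2, hI2, rfl⟩ := Finset.mem_image.1 (hDbar hK2)
  obtain ⟨hI1H, hI1ne, a, haz, ha⟩ := Finset.mem_filter.1 hI1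
  obtain ⟨hI2H, -, b, hbz, hb⟩ := Finset.mem_filter.1 hI2
  have hsub : I1 ⊆ I2 := hle I1 I2 ⟨hI1H, a, haz, ha⟩ ⟨hI2H, b, hbz, hb⟩ rfl rfl
  have hbHm : b ∈ Hm := by
    rw [heq]
    exact Finset.mem_union_left _
      (Finset.mem_sup.2 ⟨_, hK2, Finset.mem_filter.2 ⟨hbz, hb⟩⟩)
  have haI1 : a ∈ I1 := ha ▸ mem_minContaining_self H a
  have haHm : a ∈ Hm := minContaining_subset hHm hbHm (hb ▸ hsub haI1)
  rw [heq, Finset.mem_union, Finset.mem_sup] at haHm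
  rcases haHm with ⟨K, hK, haK⟩ | ha0
  · obtain ⟨I3, -, rfl⟩ := Finset.mem_image.1 (hDbar hK)
    have hI3 : minContaining H a = I3 := (Finset.mem_filter.1 haK).2
    rwa [← ha, hI3]
  · exact absurd ((ha ▸ minContaining_subset hH0 ha0).antisymm (hH0min I1 hI1H)) hI1ne
end

section
/- In a matching market in which all choice functions are path-independent and cardinal monotone, for any two stable matchings μ1 and μ2 one has P(μ1 ∨ μ2) = P(μ1) ∩ P(μ2) and P(μ1 ∧ μ2) = P(μ1) ∪ P(μ2). -/
/-- A matching market: finite disjoint sets of firms `F` and workers `W`; each firm `f`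
has a set `accF f ⊆ W` of acceptable workers and a choice function `Cf f` on subsets of
`accF f`; each worker `w` has a set `accW w ⊆ F` and a choice function `Cw w`, where
`f ∈ accW w ↔ w ∈ accF f`. -/
structure Market (F W : Type*) [Fintype F] [Fintype W] [DecidableEq F] [DecidableEq W] where
  accF : F → Finset W
  accW : W → Finset F
  compat : ∀ f w, f ∈ accW w ↔ w ∈ accF f
  Cf : F → Finset W → Finset W
  Cw : W → Finset F → Finset F
  CfSub : ∀ f S, Cf f S ⊆ S
  CwSub : ∀ w S, Cw w S ⊆ S

namespace Market

variable {F W : Type*} [Fintype F] [Fintype W] [DecidableEq F] [DecidableEq W]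

/-- The set `μ(w)` of firms matched to worker `w` under the matching `μ`. -/
def mw (M : Market F W) (μ : F → Finset W) (w : W) : Finset F :=
  Finset.univ.filter (fun f => w ∈ μ f)

/-- `μ` is a matching: each firm is matched to acceptable workers. -/
def IsMatching (M : Market F W) (μ : F → Finset W) : Prop :=
  ∀ f, μ f ⊆ M.accF f

/-- `μ` is individually rational. -/
def IndRational (M : Market F W) (μ : F → Finset W) : Prop :=
  (∀ f, M.Cf f (μ f) = μ f) ∧ (∀ w, M.Cw w (M.mw μ w) = M.mw μ w)

/-- The acceptable pair `(f, w)` blocks `μ`. -/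
def Blocks (M : Market F W) (μ : F → Finset W) (f : F) (w : W) : Prop :=
  w ∈ M.accF f ∧ w ∉ μ f ∧
    w ∈ M.Cf f (insert w (μ f)) ∧ f ∈ M.Cw w (insert f (M.mw μ w))

/-- `μ` is a stable matching. -/
def Stable (M : Market F W) (μ : F → Finset W) : Prop :=
  M.IsMatching μ ∧ M.IndRational μ ∧ ∀ f w, ¬ M.Blocks μ f w

/-- `Dom M μ2 μ1` is the partial order `μ2 ⪰ μ1` on stable matchings:
`C_f(μ2(f) ∪ μ1(f)) = μ2(f)` for every firm `f`. -/
def Dom (M : Market F W) (μ2 μ1 : F → Finset W) : Prop :=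
  ∀ f, M.Cf f (μ2 f ∪ μ1 f) = μ2 f

/-- `φ(f)`: the set of stable partners of firm `f`. -/
def phi (M : Market F W) (f : F) : Set W :=
  {w | ∃ μ, M.Stable μ ∧ w ∈ μ f}

/-- `P_f(μ) = {w ∈ φ(f) : w ∈ C_f(μ(f) ∪ {w})}`. -/
def Pf (M : Market F W) (μ : F → Finset W) (f : F) : Set W :=
  {w | w ∈ M.phi f ∧ w ∈ M.Cf f (insert w (μ f))}

/-- The P-set `P(μ) = {(f, w) : f ∈ F, w ∈ P_f(μ)}`. -/
def Pset (M : Market F W) (μ : F → Finset W) : Set (F × W) :=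
  {p | p.2 ∈ M.Pf μ p.1}

/-- All choice functions of the market are path-independent and cardinal monotone
(on their domains). -/
def PathIndepCM (M : Market F W) : Prop :=
  (∀ f, ∀ S ⊆ M.accF f, ∀ T ⊆ M.accF f, M.Cf f (S ∪ T) = M.Cf f (M.Cf f S ∪ T)) ∧
  (∀ f, ∀ S T : Finset W, S ⊆ T → T ⊆ M.accF f → (M.Cf f S).card ≤ (M.Cf f T).card) ∧
  (∀ w, ∀ S ⊆ M.accW w, ∀ T ⊆ M.accW w, M.Cw w (S ∪ T) = M.Cw w (M.Cw w S ∪ T)) ∧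
  (∀ w, ∀ S T : Finset F, S ⊆ T → T ⊆ M.accW w → (M.Cw w S).card ≤ (M.Cw w T).card)

end Market

/-- The join `μ1 ∨ μ2` of two stable matchings, defined componentwise by
`(μ1 ∨ μ2)(f) := C_f(μ1(f) ∪ μ2(f))`. -/
def Market.joinM {F W : Type*} [Fintype F] [Fintype W] [DecidableEq F] [DecidableEq W]
    (M : Market F W) (μ1 μ2 : F → Finset W) : F → Finset W :=
  fun f => M.Cf f (μ1 f ∪ μ2 f)

/-- The meet `μ1 ∧ μ2` of two stable matchings, defined componentwise by
`(μ1 ∧ μ2)(f) := ((μ1(f) ∪ μ2(f)) \ (μ1 ∨ μ2)(f)) ∪ (μ1(f) ∩ μ2(f))`. -/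
def Market.meetM {F W : Type*} [Fintype F] [Fintype W] [DecidableEq F] [DecidableEq W]
    (M : Market F W) (μ1 μ2 : F → Finset W) : F → Finset W :=
  fun f => ((μ1 f ∪ μ2 f) \ M.joinM μ1 μ2 f) ∪ (μ1 f ∩ μ2 f)

namespace Market

variable {F W : Type*} [Fintype F] [Fintype W] [DecidableEq F] [DecidableEq W]

/-- The market with the roles of firms and workers exchanged. -/
def dual (M : Market F W) : Market W F where
  accF := M.accW
  accW := M.accF
  compat w f := (M.compat f w).symm
  Cf := M.Cw
  Cw := M.Cf
  CfSub := M.CwSub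
  CwSub := M.CfSub

variable {M : Market F W} {μ μ1 μ2 : F → Finset W} {f : F} {w : W}

@[simp]
theorem mem_mw : f ∈ M.mw μ w ↔ w ∈ μ f := by simp [mw]

@[simp]
theorem dual_mw_mw : M.dual.mw (M.mw μ) = μ := by
  ext f w
  rw [mem_mw, mem_mw]

theorem PathIndepCM.dual (h : M.PathIndepCM) : M.dual.PathIndepCM :=
  ⟨h.2.2.1, h.2.2.2, h.1, h.2.1⟩

theorem Stable.dual (hμ : M.Stable μ) : M.dual.Stable (M.mw μ) := by
  obtain ⟨hm, ⟨hf, hw⟩, hb⟩ := hμ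
  refine ⟨fun w f hfw => (M.compat f w).2 (hm f (mem_mw.1 hfw)), ⟨hw, ?_⟩, ?_⟩
  · rw [dual_mw_mw]
    exact hf
  · rintro w f ⟨h1, h2, h3, h4⟩
    rw [dual_mw_mw] at h4
    exact hb f w ⟨(M.compat f w).1 h1, fun h => h2 (mem_mw.2 h), h4, h3⟩

theorem joinM_comm : M.joinM μ1 μ2 = M.joinM μ2 μ1 := by
  funext f
  simp only [joinM, Finset.union_comm]

/-- Path independence implies substitutability. -/
theorem PathIndepCM.mem_Cf_of_subset (h : M.PathIndepCM) {S T : Finset W} (hST : S ⊆ T)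
    (hT : T ⊆ M.accF f) (hS : w ∈ S) (hw : w ∈ M.Cf f T) : w ∈ M.Cf f S := by
  have e := h.1 f S (hST.trans hT) (T \ S) (Finset.sdiff_subset.trans hT)
  rw [Finset.union_sdiff_of_subset hST] at e
  rw [e] at hw
  have := M.CfSub f _ hw
  simp only [Finset.mem_union, Finset.mem_sdiff] at this
  tauto

theorem PathIndepCM.Cf_insert_Cf (h : M.PathIndepCM) {S : Finset W} (hS : S ⊆ M.accF f)
    (hw : w ∈ M.accF f) : M.Cf f (insert w (M.Cf f S)) = M.Cf f (insert w S) := by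
  have e := h.1 f S hS {w} (by simpa using hw)
  rw [Finset.union_comm, Finset.union_comm _ {w}] at e
  exact e.symm

/-- Individually rejected alternatives are rejected together. -/
theorem PathIndepCM.Cf_union_eq_left (h : M.PathIndepCM) {S T : Finset W}
    (hS : S ⊆ M.accF f) (hT : T ⊆ M.accF f) (hSS : M.Cf f S = S)
    (hrej : ∀ w ∈ T, w ∉ S → w ∉ M.Cf f (insert w S)) : M.Cf f (S ∪ T) = S := by
  have hU : S ∪ T ⊆ M.accF f := Finset.union_subset hS hT
  have hsub : M.Cf f (S ∪ T) ⊆ S := by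
    intro w hw
    by_contra hwS
    have hwT : w ∈ T := (Finset.mem_union.1 (M.CfSub f _ hw)).resolve_left hwS
    refine hrej w hwT hwS (h.mem_Cf_of_subset ?_ hU (Finset.mem_insert_self _ _) hw)
    exact Finset.insert_subset (Finset.mem_union_right _ hwT) Finset.subset_union_left
  have e := h.1 f (S ∪ T) hU S hS
  rw [Finset.union_eq_right.2 hsub, hSS, Finset.union_eq_left.2 Finset.subset_union_left] at e
  exact e

theorem Stable.union_subset (h1 : M.Stable μ1) (h2 : M.Stable μ2) :
    μ1 f ∪ μ2 f ⊆ M.accF f :=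
  Finset.union_subset (h1.1 f) (h2.1 f)

theorem PathIndepCM.mem_Cf_insert_left_of_union (h : M.PathIndepCM) (h1 : M.Stable μ1)
    (h2 : M.Stable μ2) (hw : w ∈ M.accF f)
    (hC : w ∈ M.Cf f (insert w (μ1 f ∪ μ2 f))) : w ∈ M.Cf f (insert w (μ1 f)) :=
  h.mem_Cf_of_subset (Finset.insert_subset_insert _ Finset.subset_union_left)
    (Finset.insert_subset hw (h1.union_subset h2)) (Finset.mem_insert_self _ _) hC

theorem PathIndepCM.mem_Cf_insert_left_of_join (h : M.PathIndepCM) (h1 : M.Stable μ1)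
    (h2 : M.Stable μ2) (hC : w ∈ M.joinM μ1 μ2 f) : w ∈ M.Cf f (insert w (μ1 f)) := by
  have hU := M.CfSub f _ hC
  refine h.mem_Cf_insert_left_of_union h1 h2 (h1.union_subset h2 hU) ?_
  rwa [Finset.insert_eq_of_mem hU]

theorem PathIndepCM.mem_Cf_insert_right_of_join (h : M.PathIndepCM) (h1 : M.Stable μ1)
    (h2 : M.Stable μ2) (hC : w ∈ M.joinM μ1 μ2 f) : w ∈ M.Cf f (insert w (μ2 f)) :=
  h.mem_Cf_insert_left_of_join h2 h1 (joinM_comm (M := M) ▸ hC)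

/-- A pair on which both sides' joins agree belongs to both matchings. -/
theorem PathIndepCM.mem_left_of_mem_joins (h : M.PathIndepCM) (h1 : M.Stable μ1)
    (h2 : M.Stable μ2) (hJ : w ∈ M.joinM μ1 μ2 f)
    (hK : f ∈ M.dual.joinM (M.mw μ1) (M.mw μ2) w) : w ∈ μ1 f := by
  by_contra hw
  exact h1.2.2 f w ⟨h1.union_subset h2 (M.CfSub f _ hJ), hw,
    h.mem_Cf_insert_left_of_join h1 h2 hJ,
    h.dual.mem_Cf_insert_left_of_join h1.dual h2.dual hK⟩

theorem PathIndepCM.card_right_le_card_join (h : M.PathIndepCM) (h1 : M.Stable μ1)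
    (h2 : M.Stable μ2) (f : F) : (μ2 f).card ≤ (M.joinM μ1 μ2 f).card := by
  have := h.2.1 f (μ2 f) (μ1 f ∪ μ2 f) Finset.subset_union_right (h1.union_subset h2)
  rwa [h2.2.1.1 f] at this

theorem sum_indicator_eq_card (S : Finset W) :
    ∑ w, (if w ∈ S then 1 else 0) = S.card := by simp

/-- The double count behind Alkan's theorem: the firms' join and the workers' join together
cover every pair as often as the two matchings do, and the workers' join keeps the sizes. -/
theorem PathIndepCM.join_add_dual_join (h : M.PathIndepCM) (h1 : M.Stable μ1)
    (h2 : M.Stable μ2) :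
    (∀ f w, (if w ∈ M.joinM μ1 μ2 f then 1 else 0) +
        (if f ∈ M.dual.joinM (M.mw μ1) (M.mw μ2) w then 1 else 0) =
      (if w ∈ μ1 f then 1 else 0) + (if w ∈ μ2 f then 1 else 0)) ∧
    ∀ w, (M.dual.joinM (M.mw μ1) (M.mw μ2) w).card = (M.mw μ2 w).card := by
  set J := M.joinM μ1 μ2 with hJ
  set K := M.dual.joinM (M.mw μ1) (M.mw μ2) with hK
  have hle : ∀ p ∈ (Finset.univ : Finset (F × W)),
      (if p.2 ∈ J p.1 then 1 else 0) + (if p.1 ∈ K p.2 then 1 else 0) ≤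
        (if p.2 ∈ μ1 p.1 then 1 else 0) + (if p.2 ∈ μ2 p.1 then 1 else 0) := by
    rintro ⟨f, w⟩ -
    have hJU : w ∈ J f → w ∈ μ1 f ∨ w ∈ μ2 f := fun hw =>
      Finset.mem_union.1 (M.CfSub f _ hw)
    have hKU : f ∈ K w → w ∈ μ1 f ∨ w ∈ μ2 f := fun hf => by
      simpa using M.dual.CfSub w _ hf
    have hb1 : w ∈ J f → f ∈ K w → w ∈ μ1 f := h.mem_left_of_mem_joins h1 h2
    have hb2 : w ∈ J f → f ∈ K w → w ∈ μ2 f := fun a b =>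
      h.mem_left_of_mem_joins h2 h1 (joinM_comm (M := M) ▸ a) (joinM_comm (M := M.dual) ▸ b)
    dsimp only
    split_ifs <;> simp_all
  have eJ : ∑ p : F × W, (if p.2 ∈ J p.1 then 1 else 0) = ∑ f, (J f).card := by
    rw [Fintype.sum_prod_type]
    simp only [sum_indicator_eq_card]
  have eK : ∑ p : F × W, (if p.1 ∈ K p.2 then 1 else 0) = ∑ w, (K w).card := by
    rw [Fintype.sum_prod_type_right]
    simp only [sum_indicator_eq_card]
  have e1 : ∑ p : F × W, (if p.2 ∈ μ1 p.1 then 1 else 0) = ∑ f, (μ1 f).card := by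
    rw [Fintype.sum_prod_type]
    simp only [sum_indicator_eq_card]
  have e2 : ∑ p : F × W, (if p.2 ∈ μ2 p.1 then 1 else 0) = ∑ w, (M.mw μ2 w).card := by
    rw [Fintype.sum_prod_type_right]
    simp only [← sum_indicator_eq_card, mem_mw]
  have l1 : ∑ f, (μ1 f).card ≤ ∑ f, (J f).card := Finset.sum_le_sum fun f _ => by
    rw [hJ, joinM_comm]
    exact h.card_right_le_card_join h2 h1 f
  have l2 : ∀ w ∈ Finset.univ, (M.mw μ2 w).card ≤ (K w).card := fun w _ =>
    h.dual.card_right_le_card_join h1.dual h2.dual w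
  have l2' := Finset.sum_le_sum l2
  have l3 := Finset.sum_le_sum hle
  simp only [Finset.sum_add_distrib, eJ, eK, e1, e2] at l3
  refine ⟨fun f w => ?_, fun w => ?_⟩
  · refine (Finset.sum_eq_sum_iff_of_le hle).1 ?_ (f, w) (Finset.mem_univ _)
    simp only [Finset.sum_add_distrib, eJ, eK, e1, e2]
    omega
  · exact ((Finset.sum_eq_sum_iff_of_le l2).1 (by omega) w (Finset.mem_univ _)).symm

/-- The workers' join is the firms' meet. -/
theorem PathIndepCM.mem_dual_join_iff (h : M.PathIndepCM) (h1 : M.Stable μ1)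
    (h2 : M.Stable μ2) :
    f ∈ M.dual.joinM (M.mw μ1) (M.mw μ2) w ↔ w ∈ M.meetM μ1 μ2 f := by
  have e := (h.join_add_dual_join h1 h2).1 f w
  simp only [meetM, Finset.mem_union, Finset.mem_sdiff, Finset.mem_inter]
  split_ifs at e <;> simp_all

theorem PathIndepCM.mw_meetM (h : M.PathIndepCM) (h1 : M.Stable μ1) (h2 : M.Stable μ2) :
    M.mw (M.meetM μ1 μ2) = M.dual.joinM (M.mw μ1) (M.mw μ2) := by
  ext w f
  rw [mem_mw, h.mem_dual_join_iff h1 h2]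

theorem PathIndepCM.mem_join_of_mem_mem (h : M.PathIndepCM) (h1 : M.Stable μ1)
    (h2 : M.Stable μ2) (hw1 : w ∈ μ1 f) (hw2 : w ∈ μ2 f) : w ∈ M.joinM μ1 μ2 f := by
  have e := (h.join_add_dual_join h1 h2).1 f w
  split_ifs at e <;> simp_all

theorem PathIndepCM.card_mw_join (h : M.PathIndepCM) (h1 : M.Stable μ1)
    (h2 : M.Stable μ2) (w : W) : (M.mw (M.joinM μ1 μ2) w).card = (M.mw μ1 w).card := by
  obtain ⟨e, c⟩ := h.join_add_dual_join h1 h2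
  have s := Finset.sum_congr (rfl : (Finset.univ : Finset F) = _) fun f _ => e f w
  simp only [Finset.sum_add_distrib, ← mem_mw (M := M), sum_indicator_eq_card] at s
  have := c w
  omega

/-- Workers weakly prefer each of the two matchings to the firms' join. -/
theorem PathIndepCM.Cw_union_join (h : M.PathIndepCM) (h1 : M.Stable μ1)
    (h2 : M.Stable μ2) (w : W) :
    M.Cw w (M.mw μ1 w ∪ M.mw (M.joinM μ1 μ2) w) = M.mw μ1 w := by
  refine h.dual.Cf_union_eq_left (h1.dual.1 w) ?_ (h1.2.1.2 w) ?_
  · intro f hf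
    rw [mem_mw] at hf
    exact (M.compat f w).2 (h1.union_subset h2 (M.CfSub f _ hf))
  · intro f hf hf1 hC
    rw [mem_mw] at hf hf1
    exact h1.2.2 f w ⟨h1.union_subset h2 (M.CfSub f _ hf), hf1,
      h.mem_Cf_insert_left_of_join h1 h2 hf, hC⟩

theorem PathIndepCM.stable_join (h : M.PathIndepCM) (h1 : M.Stable μ1)
    (h2 : M.Stable μ2) : M.Stable (M.joinM μ1 μ2) := by
  have hmem : M.IsMatching (M.joinM μ1 μ2) := fun f =>
    (M.CfSub f _).trans (h1.union_subset h2)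
  have hmemW : ∀ w, M.mw (M.joinM μ1 μ2) w ⊆ M.accW w := fun w f hf =>
    (M.compat f w).2 (hmem f (mem_mw.1 hf))
  have hd1 := h.Cw_union_join h1 h2
  have hd2 := h.Cw_union_join h2 h1
  rw [joinM_comm] at hd2
  have hor : ∀ {w f}, f ∈ M.mw (M.joinM μ1 μ2) w → f ∈ M.mw μ1 w ∨ f ∈ M.mw μ2 w := by
    intro w f hf
    rw [mem_mw] at hf ⊢
    rw [mem_mw]
    exact Finset.mem_union.1 (M.CfSub f _ hf)
  refine ⟨hmem, ⟨fun f => ?_, fun w => ?_⟩, ?_⟩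
  · have e := h.1 f _ (h1.union_subset h2) ∅ (Finset.empty_subset _)
    simpa only [joinM, Finset.union_empty] using e.symm
  · refine Finset.Subset.antisymm (M.CwSub w _) fun f hf => ?_
    rcases hor hf with hf' | hf'
    · rw [← hd1 w] at hf'
      exact h.dual.mem_Cf_of_subset Finset.subset_union_right
        (Finset.union_subset (h1.dual.1 w) (hmemW w)) hf hf'
    · rw [← hd2 w] at hf'
      exact h.dual.mem_Cf_of_subset Finset.subset_union_right
        (Finset.union_subset (h2.dual.1 w) (hmemW w)) hf hf'
  · rintro f w ⟨hacc, hwJ, hfC, hwC⟩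
    have haccW : f ∈ M.accW w := (M.compat f w).2 hacc
    rw [joinM, h.Cf_insert_Cf (h1.union_subset h2) hacc] at hfC
    have hwU : w ∉ μ1 f ∪ μ2 f := fun hU => hwJ (by
      rwa [Finset.insert_eq_of_mem hU] at hfC)
    have key : ∀ {ν ν' : F → Finset W}, M.Stable ν → M.Stable ν' → w ∉ ν f →
        w ∈ M.Cf f (insert w (ν f ∪ ν' f)) →
        M.Cw w (M.mw ν w ∪ M.mw (M.joinM μ1 μ2) w) = M.mw ν w →
        M.Cw w (insert f (M.mw ν w ∪ M.mw (M.joinM μ1 μ2) w)) = M.mw ν w := by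
      intro ν ν' hν hν' hwν hC hd
      have hrej : f ∉ M.Cw w (insert f (M.mw ν w)) := fun hf =>
        hν.2.2 f w ⟨hacc, hwν, h.mem_Cf_insert_left_of_union hν hν' hacc hC, hf⟩
      have e : M.Cw w (insert f (M.Cw w (M.mw ν w ∪ M.mw (M.joinM μ1 μ2) w))) =
          M.Cw w (insert f (M.mw ν w ∪ M.mw (M.joinM μ1 μ2) w)) :=
        h.dual.Cf_insert_Cf (Finset.union_subset (hν.dual.1 w) (hmemW w)) haccW
      rw [← e, hd, Finset.insert_eq, Finset.union_comm]
      refine h.dual.Cf_union_eq_left (hν.dual.1 w)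
        (Finset.singleton_subset_iff.2 haccW) (hν.2.1.2 w) ?_
      intro g hg _
      rw [Finset.mem_singleton] at hg
      rwa [hg]
    rw [Finset.mem_union, not_or] at hwU
    have k1 := key h1 h2 hwU.1 hfC (hd1 w)
    have k2 := key h2 h1 hwU.2 (by rwa [Finset.union_comm]) (hd2 w)
    have a1 : insert f (M.mw μ1 w ∪ M.mw (M.joinM μ1 μ2) w) ⊆ M.accW w :=
      Finset.insert_subset haccW (Finset.union_subset (h1.dual.1 w) (hmemW w))
    have a2 : insert f (M.mw μ2 w ∪ M.mw (M.joinM μ1 μ2) w) ⊆ M.accW w :=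
      Finset.insert_subset haccW (Finset.union_subset (h2.dual.1 w) (hmemW w))
    have hall : insert f (M.mw (M.joinM μ1 μ2) w) ⊆
        M.Cw w (insert f (M.mw (M.joinM μ1 μ2) w)) := by
      refine Finset.insert_subset hwC fun g hg => ?_
      rcases hor hg with hg' | hg'
      · rw [← k1] at hg'
        exact h.dual.mem_Cf_of_subset
          (Finset.insert_subset_insert _ Finset.subset_union_right) a1
          (Finset.mem_insert_of_mem hg) hg'
      · rw [← k2] at hg'
        exact h.dual.mem_Cf_of_subset
          (Finset.insert_subset_insert _ Finset.subset_union_right) a2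
          (Finset.mem_insert_of_mem hg) hg'
    have c1 := Finset.card_le_card hall
    rw [Finset.card_insert_of_notMem (fun hf => hwJ (mem_mw.1 hf)),
      h.card_mw_join h1 h2 w] at c1
    have c2 := h.2.2.2 w _ _
      (Finset.insert_subset_insert f Finset.subset_union_right) a1
    rw [k1] at c2
    omega

theorem PathIndepCM.stable_meet (h : M.PathIndepCM) (h1 : M.Stable μ1)
    (h2 : M.Stable μ2) : M.Stable (M.meetM μ1 μ2) := by
  have := (h.dual.stable_join h1.dual h2.dual).dual
  rw [← h.mw_meetM h1 h2, dual_mw_mw] at this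
  exact this

/-- Firms weakly prefer each of the two matchings to the meet. -/
theorem PathIndepCM.Cf_union_meet (h : M.PathIndepCM) (h1 : M.Stable μ1)
    (h2 : M.Stable μ2) (f : F) : M.Cf f (μ1 f ∪ M.meetM μ1 μ2 f) = μ1 f := by
  have := h.dual.Cw_union_join h1.dual h2.dual f
  rw [← h.mw_meetM h1 h2, dual_mw_mw, dual_mw_mw] at this
  exact this

theorem PathIndepCM.mem_join_of_mem_of_mem_Cf (h : M.PathIndepCM) (h1 : M.Stable μ1)
    (h2 : M.Stable μ2) (hw : w ∈ μ1 f) (hC : w ∈ M.Cf f (insert w (μ2 f))) :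
    w ∈ M.joinM μ1 μ2 f := by
  by_cases hw2 : w ∈ μ2 f
  · exact h.mem_join_of_mem_mem h1 h2 hw hw2
  by_contra hJ
  have hmeet : w ∈ M.meetM μ1 μ2 f := by simp [meetM, hw, hJ]
  have hK := (h.mem_dual_join_iff h1 h2).2 hmeet
  exact h2.2.2 f w ⟨h1.1 f hw, hw2, hC,
    h.dual.mem_Cf_insert_right_of_join h1.dual h2.dual hK⟩

theorem PathIndepCM.mem_Cf_insert_join (h : M.PathIndepCM) (h1 : M.Stable μ1)
    (h2 : M.Stable μ2) (hφ : w ∈ M.phi f) (hC1 : w ∈ M.Cf f (insert w (μ1 f)))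
    (hC2 : w ∈ M.Cf f (insert w (μ2 f))) : w ∈ M.Cf f (insert w (M.joinM μ1 μ2 f)) := by
  obtain ⟨ν, hν, hw⟩ := hφ
  have hacc := hν.1 f hw
  have hJ := h.mem_join_of_mem_mem (h.stable_join hν h1) (h.stable_join hν h2)
    (h.mem_join_of_mem_of_mem_Cf hν h1 hw hC1) (h.mem_join_of_mem_of_mem_Cf hν h2 hw hC2)
  have e : M.joinM (M.joinM ν μ1) (M.joinM ν μ2) f =
      M.Cf f ((ν f ∪ μ1 f) ∪ (ν f ∪ μ2 f)) := by
    simp only [joinM]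
    rw [← h.1 f _ (hν.union_subset h1) _ ((M.CfSub f _).trans (hν.union_subset h2)),
      Finset.union_comm,
      ← h.1 f _ (hν.union_subset h2) _ (hν.union_subset h1), Finset.union_comm]
  rw [e] at hJ
  rw [joinM, h.Cf_insert_Cf (h1.union_subset h2) hacc]
  refine h.mem_Cf_of_subset ?_
    (Finset.union_subset (hν.union_subset h1) (hν.union_subset h2))
    (Finset.mem_insert_self _ _) hJ
  intro x hx
  simp only [Finset.mem_insert, Finset.mem_union] at hx ⊢
  rcases hx with rfl | hx | hx <;> tauto

/-- A stable partner whom a firm rejects at `μ` would accept the firm at `μ`. -/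
theorem PathIndepCM.mem_Cw_of_notMem_Cf (h : M.PathIndepCM) (hμ : M.Stable μ)
    (hφ : w ∈ M.phi f) (hC : w ∉ M.Cf f (insert w (μ f))) :
    f ∈ M.Cw w (insert f (M.mw μ w)) := by
  obtain ⟨ν, hν, hw⟩ := hφ
  have hJ : w ∉ M.joinM ν μ f := fun hJ => hC (h.mem_Cf_insert_right_of_join hν hμ hJ)
  have hmeet : w ∈ M.meetM ν μ f := by simp [meetM, hw, hJ]
  exact h.dual.mem_Cf_insert_right_of_join hν.dual hμ.dual
    ((h.mem_dual_join_iff hν hμ).2 hmeet)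

theorem PathIndepCM.Pset_join (h : M.PathIndepCM) (h1 : M.Stable μ1) (h2 : M.Stable μ2) :
    M.Pset (M.joinM μ1 μ2) = M.Pset μ1 ∩ M.Pset μ2 := by
  ext ⟨f, w⟩
  refine ⟨fun ⟨hφ, hC⟩ => ?_, fun ⟨⟨hφ, hC1⟩, _, hC2⟩ =>
    ⟨hφ, h.mem_Cf_insert_join h1 h2 hφ hC1 hC2⟩⟩
  obtain ⟨ν, hν, hw⟩ := id hφ
  have hacc := hν.1 f hw
  dsimp only at hC
  rw [joinM, h.Cf_insert_Cf (h1.union_subset h2) hacc] at hC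
  exact ⟨⟨hφ, h.mem_Cf_insert_left_of_union h1 h2 hacc hC⟩, hφ,
    h.mem_Cf_insert_left_of_union h2 h1 hacc (by rwa [Finset.union_comm])⟩

theorem meetM_comm : M.meetM μ1 μ2 = M.meetM μ2 μ1 := by
  funext f
  simp only [meetM, joinM_comm (μ1 := μ1), Finset.union_comm (μ1 f), Finset.inter_comm (μ1 f)]

theorem PathIndepCM.Pset_subset_Pset_meet (h : M.PathIndepCM) (h1 : M.Stable μ1)
    (h2 : M.Stable μ2) : M.Pset μ1 ⊆ M.Pset (M.meetM μ1 μ2) := by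
  rintro ⟨f, w⟩ ⟨hφ, hC⟩
  refine ⟨hφ, ?_⟩
  obtain ⟨ν, hν, hw⟩ := hφ
  have hacc := hν.1 f hw
  have hU := h1.union_subset (f := f) (h.stable_meet h1 h2)
  dsimp only at hC hw ⊢
  rw [← h.Cf_union_meet h1 h2 f, h.Cf_insert_Cf hU hacc, Finset.union_comm] at hC
  exact h.mem_Cf_insert_left_of_union (h.stable_meet h1 h2) h1 hacc hC

theorem PathIndepCM.Pset_meet (h : M.PathIndepCM) (h1 : M.Stable μ1) (h2 : M.Stable μ2) :
    M.Pset (M.meetM μ1 μ2) = M.Pset μ1 ∪ M.Pset μ2 := by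
  refine Set.Subset.antisymm ?_ (Set.union_subset (h.Pset_subset_Pset_meet h1 h2)
    (meetM_comm (M := M) ▸ h.Pset_subset_Pset_meet h2 h1))
  rintro ⟨f, w⟩ ⟨hφ, hC⟩
  by_contra hnot
  have hn1 : w ∉ M.Cf f (insert w (μ1 f)) := fun hw => hnot (Or.inl ⟨hφ, hw⟩)
  have hn2 : w ∉ M.Cf f (insert w (μ2 f)) := fun hw => hnot (Or.inr ⟨hφ, hw⟩)
  have notMem : ∀ {ν : F → Finset W}, M.Stable ν → w ∉ M.Cf f (insert w (ν f)) → w ∉ ν f := by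
    intro ν hν hn hw
    rw [Finset.insert_eq_of_mem hw, hν.2.1.1 f] at hn
    exact hn hw
  obtain ⟨ν, hν, hw⟩ := id hφ
  have hφ' : f ∈ M.dual.phi w := ⟨M.mw ν, hν.dual, mem_mw.2 hw⟩
  have hCw := h.dual.mem_Cf_insert_join h1.dual h2.dual hφ'
    (h.mem_Cw_of_notMem_Cf h1 hφ hn1) (h.mem_Cw_of_notMem_Cf h2 hφ hn2)
  rw [← h.mw_meetM h1 h2] at hCw
  refine (h.stable_meet h1 h2).2.2 f w ⟨hν.1 f hw, fun hm => ?_, hC, hCw⟩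
  have := notMem h1 hn1
  have := notMem h2 hn2
  simp_all [meetM]

end Market

/-- In a matching market in which all choice functions are
path-independent and cardinal monotone, for any two stable matchings `μ1, μ2`:
`P(μ1 ∨ μ2) = P(μ1) ∩ P(μ2)` and `P(μ1 ∧ μ2) = P(μ1) ∪ P(μ2)`. -/
theorem stmt_10 {F W : Type*} [Fintype F] [Fintype W] [DecidableEq F] [DecidableEq W]
    (M : Market F W) (h : M.PathIndepCM)
    (μ1 μ2 : F → Finset W) (h1 : M.Stable μ1) (h2 : M.Stable μ2) :
    M.Pset (M.joinM μ1 μ2) = M.Pset μ1 ∩ M.Pset μ2 ∧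
    M.Pset (M.meetM μ1 μ2) = M.Pset μ1 ∪ M.Pset μ2 := by
  exact ⟨h.Pset_join h1 h2, h.Pset_meet h1 h2⟩
end

section
/- In a matching market in which all choice functions are path-independent and cardinal monotone, let μ1, μ2, μ3 be stable matchings with μ1 ≻ μ2 ≻ μ3. If w ∈ μ1(f) \ μ2(f) for some firm f, then w ∉ μ3(f). -/
/-- A path-independent choice function is substitutable: an element chosen from `T` is chosen
from every subset of `T` that contains it. -/
theorem mem_choice_of_subset {α : Type*} [DecidableEq α] {C : Finset α → Finset α}
    {A S T : Finset α} {a : α} (hsub : ∀ S, C S ⊆ S)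
    (hPI : ∀ S ⊆ A, ∀ T ⊆ A, C (S ∪ T) = C (C S ∪ T))
    (hT : T ⊆ A) (hST : S ⊆ T) (haS : a ∈ S) (haT : a ∈ C T) : a ∈ C S := by
  by_contra hne
  have hunion : S ∪ T.erase a = T := by
    ext x
    grind
  have hPI' := hPI S (hST.trans hT) (T.erase a) ((Finset.erase_subset a T).trans hT)
  rw [hunion] at hPI'
  have hmem := hsub _ (hPI' ▸ haT)
  simp [hne] at hmem

/-- In a matching market in which all choice functions are
path-independent and cardinal monotone, let `μ1, μ2, μ3` be stable matchings with
`μ1 ≻ μ2 ≻ μ3`. If `w ∈ μ1(f) \ μ2(f)` for some firm `f`, then `w ∉ μ3(f)`. -/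
theorem stmt_14 {F W : Type*} [Fintype F] [Fintype W] [DecidableEq F] [DecidableEq W]
    (M : Market F W) (h : M.PathIndepCM)
    (μ1 μ2 μ3 : F → Finset W)
    (h1 : M.Stable μ1) (h2 : M.Stable μ2) (h3 : M.Stable μ3)
    (h12 : M.Dom μ1 μ2) (hne12 : μ1 ≠ μ2)
    (h23 : M.Dom μ2 μ3) (hne23 : μ2 ≠ μ3)
    (f : F) (w : W) (hw1 : w ∈ μ1 f) (hw2 : w ∉ μ2 f) :
    w ∉ μ3 f := by
  intro hw3
  have hPI := h.1 f
  have hA1 := h1.1 f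
  have hA2 := h2.1 f
  have hA3 := h3.1 f
  have hchosen : w ∈ M.Cf f (μ2 f ∪ {w}) := by
    refine mem_choice_of_subset (T := μ1 f ∪ μ2 f) (M.CfSub f) hPI
      (Finset.union_subset hA1 hA2) ?_ (by simp) ((h12 f).symm ▸ hw1)
    intro x
    grind
  have hrejected : M.Cf f (μ2 f ∪ {w}) = μ2 f := by
    have hPI' := hPI (μ2 f ∪ μ3 f) (Finset.union_subset hA2 hA3) {w}
      (Finset.singleton_subset_iff.mpr (hA3 hw3))
    have hunion : μ2 f ∪ μ3 f ∪ {w} = μ2 f ∪ μ3 f :=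
      Finset.union_eq_left.mpr (by simp [hw3])
    rwa [hunion, h23 f, eq_comm] at hPI'
  exact hw2 (hrejected ▸ hchosen)
end
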